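/- The sphere S^2 cannot be covered by open sets, none containing a pair of antipodal points, such that every point of S^2 is contained in at most 2 of the sets. -/

import Mathlib

open Set Topology
open scoped Pointwise

section Components

variable {X : Type*} [TopologicalSpace X] [LocallyConnectedSpace X] {A W : Set X}

lemma IsOpen.diff_connectedComponentIn (hW : IsOpen W) (x : X) :
    IsOpen (W \ connectedComponentIn W x) := by
  rw [isOpen_iff_forall_mem_open]
  rintro y ⟨hy, hyE⟩
  refine ⟨connectedComponentIn W y, fun z hz => ⟨connectedComponentIn_subset _ _ hz,
    fun hzE => hyE ?_⟩, hW.connectedComponentIn, mem_connectedComponentIn hy⟩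
  rw [connectedComponentIn_eq hzE, ← connectedComponentIn_eq hz]
  exact mem_connectedComponentIn hy

lemma inter_connectedComponentIn_nonempty [PreconnectedSpace X] (hA : IsOpen A) (hW : IsOpen W)
    (hAW : A ∪ W = univ) (hne : A.Nonempty) {x : X} (hx : x ∈ W) :
    (A ∩ connectedComponentIn W x).Nonempty := by
  have key := isPreconnected_univ (A ∪ (W \ connectedComponentIn W x)) (connectedComponentIn W x)
    (hA.union (hW.diff_connectedComponentIn x)) hW.connectedComponentIn
    (fun z _ => by
      have := hAW.symm.subset (mem_univ z)
      by_cases hz : z ∈ connectedComponentIn W x <;> grind)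
    (by simpa using hne.mono subset_union_left)
    ⟨x, mem_univ x, mem_connectedComponentIn hx⟩
  obtain ⟨z, -, hz | hz, hzE⟩ := key
  · exact ⟨z, hz, hzE⟩
  · exact absurd hzE hz.2

lemma isPreconnected_union_diff_connectedComponentIn [PreconnectedSpace X] (hA : IsOpen A)
    (hW : IsOpen W) (hAW : A ∪ W = univ) (hne : A.Nonempty) (hAc : IsPreconnected A) (x : X) :
    IsPreconnected (A ∪ (W \ connectedComponentIn W x)) := by
  obtain ⟨a, ha⟩ := hne
  refine isPreconnected_of_forall a fun y hy => ?_
  rcases hy with hy | ⟨hy, hyE⟩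
  · exact ⟨A, subset_union_left, ha, hy, hAc⟩
  · obtain ⟨z, hzA, hzy⟩ := inter_connectedComponentIn_nonempty hA hW hAW ⟨a, ha⟩ hy
    refine ⟨A ∪ connectedComponentIn W y, ?_, Or.inl ha, Or.inr (mem_connectedComponentIn hy),
      IsPreconnected.union z hzA hzy hAc isPreconnected_connectedComponentIn⟩
    refine union_subset_union_right _ fun w hw => ⟨connectedComponentIn_subset _ _ hw,
      fun hwE => hyE ?_⟩
    rw [connectedComponentIn_eq hwE, ← connectedComponentIn_eq hw]
    exact mem_connectedComponentIn hy

end Components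

section Involution

variable {X : Type*} [TopologicalSpace X] [InvolutiveNeg X] [ContinuousNeg X]

lemma IsPreconnected.neg_set {A : Set X} (hA : IsPreconnected A) : IsPreconnected (-A) := by
  rw [← image_neg_eq_neg]
  exact hA.image _ continuous_neg.continuousOn

/-- If `A` is antipode-free and `A ∪ W` is the whole space, then the connected component of `W`
containing `-A` is not antipode-free. -/
lemma not_disjoint_neg_connectedComponentIn [PreconnectedSpace X] [LocallyConnectedSpace X]
    {A W : Set X}
    (hA : IsOpen A) (hAc : IsPreconnected A) (hAn : Disjoint A (-A)) (hW : IsOpen W)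
    (hAW : A ∪ W = univ) {a : X} (ha : a ∈ A) :
    ¬ Disjoint (connectedComponentIn W (-a)) (-connectedComponentIn W (-a)) := by
  intro hD
  have hcov (z : X) : z ∈ A ∨ z ∈ W := hAW.symm.subset (mem_univ z)
  rw [Set.disjoint_left] at hAn
  have hAW' : -A ⊆ W := fun z hz => (hcov z).resolve_left fun h => hAn h hz
  have haW : -a ∈ W := hAW' (by simpa using ha)
  have hAD : -A ⊆ connectedComponentIn W (-a) :=
    hAc.neg_set.subset_connectedComponentIn (by simpa using ha) hAW'
  have hRc := (isPreconnected_union_diff_connectedComponentIn hA hW hAW ⟨a, ha⟩ hAc (-a)).neg_set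
  have hRD := hRc.subset_connectedComponentIn (x := -a) (F := W) (by simp [ha]) (by
    intro z hz
    refine (hcov z).resolve_left fun hzA => ?_
    have h1 : -z ∈ connectedComponentIn W (-a) := hAD (by simpa using hzA)
    rcases hz with hz | hz
    · exact hAn hzA hz
    · exact hz.2 h1)
  have hopen : IsOpen (connectedComponentIn W (-a)) := hW.connectedComponentIn
  have haD : -a ∈ connectedComponentIn W (-a) := mem_connectedComponentIn haW
  obtain ⟨z, -, hz1, hz2⟩ := isPreconnected_univ _ _ hopen hopen.neg
    (fun z _ => by
      by_cases hz : -z ∈ connectedComponentIn W (-a)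
      · exact Or.inr hz
      · refine Or.inl (hRD ?_)
        rcases hcov (-z) with h | h
        · exact Or.inl h
        · exact Or.inr ⟨h, hz⟩)
    ⟨-a, mem_univ _, haD⟩ ⟨a, mem_univ _, haD⟩
  exact Set.disjoint_left.1 hD hz1 hz2

lemma disjoint_neg_of_neg_inter_disjoint {E F : Set X} (hE : IsOpen E) (hF : IsOpen F)
    (hFc : IsPreconnected F) (hEF : E ∪ F = univ) (hne : (E ∩ F).Nonempty)
    (h : ∀ z ∈ E ∩ F, -z ∉ F) : Disjoint F (-F) := by
  rw [Set.disjoint_left]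
  intro z hz hzn
  have hcov (z : X) : z ∈ E ∨ z ∈ F := hEF.symm.subset (mem_univ z)
  obtain ⟨c, hcE, hcF⟩ := hne
  obtain ⟨w, hw, hw'⟩ := hFc.neg_set E F hE hF (fun z _ => hcov z)
    ⟨-c, by simpa using hcF, (hcov (-c)).resolve_right (h c ⟨hcE, hcF⟩)⟩ ⟨z, hzn, hz⟩
  exact h w hw' hw

/-- If two connected open sets cover the space and their intersection is nonempty, connected and
antipode-free, then one of them is antipode-free. -/
lemma disjoint_neg_or_disjoint_neg {E F : Set X} (hE : IsOpen E) (hF : IsOpen F)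
    (hEc : IsPreconnected E) (hFc : IsPreconnected F) (hEF : E ∪ F = univ)
    (hne : (E ∩ F).Nonempty) (hc : IsPreconnected (E ∩ F)) (hn : Disjoint (E ∩ F) (-(E ∩ F))) :
    Disjoint E (-E) ∨ Disjoint F (-F) := by
  by_cases h : ∀ z ∈ E ∩ F, -z ∉ F
  · exact Or.inr (disjoint_neg_of_neg_inter_disjoint hE hF hFc hEF hne h)
  refine Or.inl (disjoint_neg_of_neg_inter_disjoint hF hE hEc (by rwa [union_comm])
    (by rwa [inter_comm]) fun z hz hzE => ?_)
  push Not at h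
  obtain ⟨w, hw, hwF⟩ := h
  obtain ⟨v, hv, hv'⟩ := hc.neg_set E F hE hF (fun z _ => hEF.symm.subset (mem_univ z))
    ⟨-z, by simpa [and_comm] using hz, hzE⟩ ⟨-w, by simpa using hw, hwF⟩
  exact Set.disjoint_left.1 hn hv' hv

/-- A unicoherent space with an involution has no finite cover of multiplicity two by connected
antipode-free open sets. -/
lemma false_of_finite_cover_of_unicoherent [PreconnectedSpace X] [LocallyConnectedSpace X]
    [Nonempty X]
    (huni : ∀ P Q : Set X, IsOpen P → IsOpen Q → IsPreconnected P → IsPreconnected Q →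
      P ∪ Q = univ → IsPreconnected (P ∩ Q))
    {𝒱 : Set (Set X)} (hfin : 𝒱.Finite) (hopen : ∀ V ∈ 𝒱, IsOpen V)
    (hconn : ∀ V ∈ 𝒱, IsConnected V) (hanti : ∀ V ∈ 𝒱, Disjoint V (-V)) (hcov : ⋃₀ 𝒱 = univ)
    (hmult : ∀ A ∈ 𝒱, ∀ B ∈ 𝒱, ∀ C ∈ 𝒱, A ≠ B → A ≠ C → B ≠ C → A ∩ B ∩ C = ∅) : False := by
  have hcov' (z : X) : ∃ V ∈ 𝒱, z ∈ V := hcov.symm.subset (mem_univ z)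
  have hpt (V : Set X) : ∃ a, V ∈ 𝒱 → a ∈ V := by
    by_cases hV : V ∈ 𝒱
    · exact (hconn V hV).nonempty.imp fun a ha _ => ha
    · exact ⟨Classical.arbitrary X, fun h => absurd h hV⟩
  choose a ha using hpt
  let W (A : Set X) : Set X := ⋃₀ (𝒱 \ {A})
  let E (A : Set X) : Set X := connectedComponentIn (W A) (-(a A))
  have hW (A : Set X) : IsOpen (W A) := isOpen_sUnion fun V hV => hopen V hV.1
  have hAW (A : Set X) : A ∪ W A = univ := by
    refine eq_univ_of_forall fun z => ?_
    obtain ⟨V, hV, hz⟩ := hcov' z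
    by_cases hVA : V = A
    · exact Or.inl (hVA ▸ hz)
    · exact Or.inr ⟨V, ⟨hV, hVA⟩, hz⟩
  have hEanti (A : Set X) (hA : A ∈ 𝒱) : ¬ Disjoint (E A) (-E A) :=
    not_disjoint_neg_connectedComponentIn (hopen A hA) (hconn A hA).isPreconnected (hanti A hA)
      (hW A) (hAW A) (ha A hA)
  have hne : 𝒱.Nonempty := (hcov' (Classical.arbitrary X)).imp fun V hV => hV.1
  obtain ⟨A, hA, hmin⟩ := hfin.exists_minimalFor E 𝒱 hne
  have haW : -(a A) ∈ W A := by
    by_contra h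
    exact hEanti A hA (by simp [E, connectedComponentIn_eq_empty h])
  obtain ⟨z, hzA, hzE⟩ := inter_connectedComponentIn_nonempty (hopen A hA) (hW A) (hAW A)
    (hconn A hA).nonempty haW
  change z ∈ E A at hzE
  obtain ⟨B, ⟨hB, hBA⟩, hzB⟩ := connectedComponentIn_subset _ _ hzE
  replace hBA : B ≠ A := hBA
  let F : Set X := A ∪ (W A \ E A)
  let G : Set X := ⋃₀ (𝒱 \ {A, B})
  have hG : IsOpen G := isOpen_sUnion fun V hV => hopen V hV.1
  have hEo : IsOpen (E A) := (hW A).connectedComponentIn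
  have hFo : IsOpen F := (hopen A hA).union ((hW A).diff_connectedComponentIn _)
  have hEc : IsPreconnected (E A) := isPreconnected_connectedComponentIn
  have hFc : IsPreconnected F := isPreconnected_union_diff_connectedComponentIn (hopen A hA)
    (hW A) (hAW A) (hconn A hA).nonempty (hconn A hA).isPreconnected _
  have hEF : E A ∪ F = univ := by
    ext w
    have hw : w ∈ A ∪ W A := (hAW A).symm.subset (mem_univ w)
    simp only [F, mem_union, mem_sdiff, mem_univ, iff_true] at hw ⊢
    tauto
  have hC : E A ∩ F = E A ∩ A := by
    ext w
    simp only [F, mem_union, mem_sdiff, mem_inter_iff]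
    tauto
  have hCc : IsPreconnected (E A ∩ F) := huni _ _ hEo hFo hEc hFc hEF
  have hCG : Disjoint (E A ∩ F) G := by
    rw [Set.disjoint_left]
    intro w hw hwG
    rw [hC] at hCc hw
    obtain ⟨v, ⟨-, hvA⟩, hvB, V, ⟨hV, hVAB⟩, hvV⟩ := hCc B G (hopen B hB) hG
      (fun v hv => by
        obtain ⟨V, ⟨hV, hVA⟩, hvV⟩ := connectedComponentIn_subset _ _ hv.1
        by_cases hVB : V = B
        · exact Or.inl (hVB ▸ hvV)
        · exact Or.inr ⟨V, ⟨hV, by simp_all⟩, hvV⟩)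
      ⟨z, ⟨hzE, hzA⟩, hzB⟩ ⟨w, hw, hwG⟩
    simp only [mem_insert_iff, mem_singleton_iff, not_or] at hVAB
    have := hmult A hA B hB V hV hBA.symm (Ne.symm hVAB.1) (Ne.symm hVAB.2)
    exact (this.subset ⟨⟨hvA, hvB⟩, hvV⟩ : v ∈ (∅ : Set X))
  have hFanti : Disjoint F (-F) := by
    refine (disjoint_neg_or_disjoint_neg hEo hFo hEc hFc hEF ?_ hCc ?_).resolve_left (hEanti A hA)
    · rw [hC]; exact ⟨z, hzE, hzA⟩
    · rw [hC]
      exact (hanti A hA).mono inter_subset_right (neg_subset_neg.2 inter_subset_right)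
  have hEB : E B ⊆ F ∪ (E A ∩ G) := by
    intro w hw
    obtain ⟨V, ⟨hV, hVB⟩, hwV⟩ := connectedComponentIn_subset _ _ hw
    by_cases hwA : w ∈ A
    · exact Or.inl (Or.inl hwA)
    by_cases hwE : w ∈ E A
    · refine Or.inr ⟨hwE, V, ⟨hV, ?_⟩, hwV⟩
      rintro (rfl | h)
      exacts [hwA hwV, hVB h]
    · exact Or.inl (Or.inr ⟨((hAW A).symm.subset (mem_univ w)).resolve_left hwA, hwE⟩)
  have hFG : Disjoint F (E A ∩ G) := by
    rw [Set.disjoint_left] at hCG ⊢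
    exact fun w hwF hw => hCG ⟨hw.1, hwF⟩ hw.2
  rcases IsPreconnected.subset_or_subset hFo (hEo.inter hG) hFG hEB
    isPreconnected_connectedComponentIn with h | h
  · exact hEanti B hB (hFanti.mono h (neg_subset_neg.2 h))
  · have hle : E A ⊆ E B := hmin hB fun w hw => (h hw).1
    exact Set.disjoint_left.1 hCG (hC.symm.subset ⟨hzE, hzA⟩) (h (hle hzE)).2

end Involution

section Unicoherence

variable {X : Type*} [TopologicalSpace X]

/-- A normal space all of whose maps to the circle lift to the line is unicoherent. -/
lemma isPreconnected_inter_of_lift [NormalSpace X]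
    (hlift : ∀ g : X → Circle, Continuous g → ∀ (x₀ : X) (t : ℝ), Circle.exp t = g x₀ →
      ∃ θ : X → ℝ, Continuous θ ∧ (∀ x, Circle.exp (θ x) = g x) ∧ θ x₀ = t)
    {P Q : Set X} (hP : IsOpen P) (hQ : IsOpen Q) (hPc : IsPreconnected P)
    (hQc : IsPreconnected Q) (hPQ : P ∪ Q = univ) : IsPreconnected (P ∩ Q) := by
  classical
  intro U V hU hV hUV hUne hVne
  by_contra hcon
  obtain ⟨w₁, hw₁, hw₁U⟩ := hUne
  obtain ⟨w₂, hw₂, hw₂V⟩ := hVne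
  have hcov (x : X) : x ∈ P ∨ x ∈ Q := hPQ.symm.subset (mem_univ x)
  obtain ⟨u, hu0, hu1, -⟩ := exists_continuous_zero_one_of_isClosed hQ.isClosed_compl
    hP.isClosed_compl (by
      rw [Set.disjoint_left]
      intro x hx hx'
      exact (hcov x).elim hx' hx)
  let T : Set X := P ∩ Q ∩ V
  have hT : IsOpen T := (hP.inter hQ).inter hV
  have hfr : ∀ x ∈ frontier T, x ∉ P ∩ Q := by
    intro x hx hxPQ
    have hxT : x ∉ T := by rw [hT.frontier_eq] at hx; exact hx.2
    have hxU : x ∈ U := (hUV hxPQ).resolve_right fun h => hxT ⟨hxPQ, h⟩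
    obtain ⟨y, ⟨hy1, hy2⟩, hy3⟩ := mem_closure_iff.1 (frontier_subset_closure hx) _
      ((hP.inter hQ).inter hU) ⟨hxPQ, hxU⟩
    exact hcon ⟨y, hy1, hy2, hy3.2⟩
  have hfrP : ∀ x ∈ P ∩ frontier T, u x = 0 := fun x hx => hu0 fun hxQ => hfr x hx.2 ⟨hx.1, hxQ⟩
  have hfrQ : ∀ x ∈ Q ∩ frontier T, u x = 1 := fun x hx => hu1 fun hxP => hfr x hx.2 ⟨hxP, hx.1⟩
  have hwT : w₁ ∉ T := fun h => hcon ⟨w₁, hw₁, hw₁U, h.2⟩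
  let ψP : X → ℝ := fun x => if x ∈ T then -(Real.pi * u x) else Real.pi * u x
  let ψQ : X → ℝ := fun x => if x ∈ T then 2 * Real.pi - Real.pi * u x else Real.pi * u x
  have hψP : ContinuousOn ψP P := by
    refine ContinuousOn.if (fun x hx => ?_) (by fun_prop) (by fun_prop)
    simp [hfrP x hx]
  have hψQ : ContinuousOn ψQ Q := by
    refine ContinuousOn.if (fun x hx => ?_) (by fun_prop) (by fun_prop)
    rw [hfrQ x hx]; ring
  have hexp (x : X) : Circle.exp (ψP x) = Circle.exp (ψQ x) := by
    simp only [ψP, ψQ]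
    split_ifs
    · rw [sub_eq_neg_add, Circle.exp_add, Circle.exp_two_pi, mul_one]
    · rfl
  have hg : Continuous fun x => Circle.exp (ψP x) := by
    rw [continuous_iff_continuousAt]
    intro x
    rcases hcov x with hx | hx
    · exact (Circle.exp.continuous.comp_continuousOn hψP).continuousAt (hP.mem_nhds hx)
    · simp only [hexp]
      exact (Circle.exp.continuous.comp_continuousOn hψQ).continuousAt (hQ.mem_nhds hx)
  obtain ⟨θ, hθc, hθ, hθ1⟩ := hlift _ hg w₁ (ψP w₁) rfl
  have h1 := Circle.isCoveringMap_exp.eqOn_of_comp_eqOn hPc hθc.continuousOn hψP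
    (fun x _ => hθ x) hw₁.1 hθ1
  have h2 := Circle.isCoveringMap_exp.eqOn_of_comp_eqOn hQc hθc.continuousOn hψQ
    (fun x _ => (hθ x).trans (hexp x)) hw₁.2 (by rw [hθ1]; simp [ψP, ψQ, hwT])
  have h3 : ψP w₂ = ψQ w₂ := (h1 hw₂.1).symm.trans (h2 hw₂.2)
  have hw₂T : w₂ ∈ T := ⟨hw₂, hw₂V⟩
  simp only [ψP, ψQ, if_pos hw₂T] at h3
  linarith [Real.pi_pos]

end Unicoherence

section Sphere

/-- The point of the unit sphere in the direction `(v, ε √(1 - ‖v‖²))`; for `‖v‖ ≤ 1` and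
`ε = ± 1` this is the point of the upper or lower hemisphere lying over `v`. -/
noncomputable def hemisphereVec (ε : ℝ) (v : ℂ) : EuclideanSpace ℝ (Fin 3) :=
  !₂[v.re, v.im, ε * √(1 - ‖v‖ ^ 2)]

lemma norm_sq_hemisphereVec {ε : ℝ} (hε : ε ^ 2 = 1) (v : ℂ) :
    ‖hemisphereVec ε v‖ ^ 2 = ‖v‖ ^ 2 + √(1 - ‖v‖ ^ 2) ^ 2 := by
  have h : ‖v‖ ^ 2 = v.re * v.re + v.im * v.im := by
    rw [Complex.sq_norm, Complex.normSq_apply]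
  rw [EuclideanSpace.norm_sq_eq, Fin.sum_univ_three]
  simp only [hemisphereVec, Real.norm_eq_abs, sq_abs]
  simp [mul_pow, hε]
  linarith

lemma hemisphereVec_ne_zero {ε : ℝ} (hε : ε ^ 2 = 1) (v : ℂ) : hemisphereVec ε v ≠ 0 := by
  intro h
  have h1 := norm_sq_hemisphereVec hε v
  rw [h, norm_zero] at h1
  have h2 : ‖v‖ ^ 2 = 0 := by nlinarith [sq_nonneg ‖v‖, sq_nonneg √(1 - ‖v‖ ^ 2)]
  rw [h2] at h1
  norm_num at h1

/-- The parametrization of a closed hemisphere by the unit disc, extended to the plane. -/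
noncomputable def hemisphereMap (ε : ℝ) (hε : ε ^ 2 = 1) (v : ℂ) :
    Metric.sphere (0 : EuclideanSpace ℝ (Fin 3)) 1 :=
  ⟨‖hemisphereVec ε v‖⁻¹ • hemisphereVec ε v, by
    simp [norm_smul, hemisphereVec_ne_zero hε v]⟩

lemma continuous_hemisphereMap {ε : ℝ} (hε : ε ^ 2 = 1) : Continuous (hemisphereMap ε hε) := by
  have hc : Continuous (hemisphereVec ε) := by
    unfold hemisphereVec
    refine (PiLp.continuous_toLp 2 _).comp (continuous_pi fun i => ?_)
    fin_cases i <;> simp <;> fun_prop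
  refine Continuous.subtype_mk ?_ _
  exact (hc.norm.inv₀ fun v => norm_ne_zero_iff.2 (hemisphereVec_ne_zero hε v)).smul hc

/-- The orthogonal projection of the sphere to the equatorial plane. -/
noncomputable def equatorProj (x : Metric.sphere (0 : EuclideanSpace ℝ (Fin 3)) 1) : ℂ :=
  ⟨x.1 0, x.1 1⟩

lemma continuous_equatorProj : Continuous equatorProj := by
  have : equatorProj = fun x => ((x.1 0 : ℝ) : ℂ) + (x.1 1 : ℝ) * Complex.I := by
    ext x; simp [equatorProj, Complex.mk_eq_add_mul_I]
  rw [this]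
  fun_prop

lemma norm_sq_equatorProj (x : Metric.sphere (0 : EuclideanSpace ℝ (Fin 3)) 1) :
    ‖equatorProj x‖ ^ 2 = 1 - x.1 2 ^ 2 := by
  have h : ‖x.1‖ ^ 2 = 1 := by simp
  rw [EuclideanSpace.norm_sq_eq, Fin.sum_univ_three] at h
  simp only [Real.norm_eq_abs, sq_abs] at h
  rw [Complex.sq_norm, Complex.normSq_apply]
  simp only [equatorProj]
  linarith

lemma hemisphereMap_equatorProj {ε : ℝ} (hε : ε ^ 2 = 1)
    {x : Metric.sphere (0 : EuclideanSpace ℝ (Fin 3)) 1} (hx : 0 ≤ ε * x.1 2) :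
    hemisphereMap ε hε (equatorProj x) = x := by
  have h : hemisphereVec ε (equatorProj x) = x.1 := by
    have hs : ε * √(1 - ‖equatorProj x‖ ^ 2) = x.1 2 := by
      have : 1 - ‖equatorProj x‖ ^ 2 = (ε * x.1 2) ^ 2 := by
        rw [norm_sq_equatorProj, mul_pow, hε]; ring
      rw [this, Real.sqrt_sq hx, ← mul_assoc, ← sq, hε, one_mul]
    ext i
    rw [hemisphereVec, hs]
    fin_cases i <;> simp [equatorProj]
  refine Subtype.ext ?_
  simp [hemisphereMap, h]

lemma hemisphereMap_eq_of_norm_eq_one {ε δ : ℝ} (hε : ε ^ 2 = 1) (hδ : δ ^ 2 = 1) {v : ℂ}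
    (hv : ‖v‖ = 1) : hemisphereMap ε hε v = hemisphereMap δ hδ v := by
  simp [hemisphereMap, hemisphereVec, hv]

lemma exists_lift_circle_of_simplyConnected {Y : Type*} [TopologicalSpace Y]
    [SimplyConnectedSpace Y] [LocallyPathConnectedSpace Y] {g : Y → Circle} (hg : Continuous g)
    (y₀ : Y) {t : ℝ} (ht : Circle.exp t = g y₀) :
    ∃ θ : Y → ℝ, Continuous θ ∧ (∀ y, Circle.exp (θ y) = g y) ∧ θ y₀ = t := by
  obtain ⟨F, ⟨hF0, hF⟩, -⟩ :=
    Circle.isCoveringMap_exp.existsUnique_continuousMap_lifts ⟨g, hg⟩ y₀ t ht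
  exact ⟨F, F.continuous, fun y => congr_fun hF y, hF0⟩

lemma exists_lift_circle_two_sphere {g : Metric.sphere (0 : EuclideanSpace ℝ (Fin 3)) 1 → Circle}
    (hg : Continuous g) (x₀ : Metric.sphere (0 : EuclideanSpace ℝ (Fin 3)) 1) {t : ℝ}
    (ht : Circle.exp t = g x₀) :
    ∃ θ : Metric.sphere (0 : EuclideanSpace ℝ (Fin 3)) 1 → ℝ,
      Continuous θ ∧ (∀ x, Circle.exp (θ x) = g x) ∧ θ x₀ = t := by
  have hp : (1 : ℝ) ^ 2 = 1 := by norm_num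
  have hm : (-1 : ℝ) ^ 2 = 1 := by norm_num
  obtain ⟨s, hs⟩ : ∃ s, Circle.exp s = g (hemisphereMap 1 hp 1) :=
    ⟨_, Circle.exp_arg _⟩
  obtain ⟨α, hαc, hα, hα1⟩ := exists_lift_circle_of_simplyConnected
    (hg.comp (continuous_hemisphereMap hp)) 1 hs
  obtain ⟨β, hβc, hβ, hβ1⟩ := exists_lift_circle_of_simplyConnected
    (hg.comp (continuous_hemisphereMap hm)) 1 (t := s)
    (by rw [hs, Function.comp_apply, hemisphereMap_eq_of_norm_eq_one hp hm (by simp)])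
  have hcirc : IsPreconnected (Metric.sphere (0 : ℂ) 1) :=
    isPreconnected_sphere (by rw [Complex.rank_real_complex]; norm_num) 0 1
  have hαβ := Circle.isCoveringMap_exp.eqOn_of_comp_eqOn hcirc hαc.continuousOn hβc.continuousOn
    (fun v hv => by
      have : ‖v‖ = 1 := by simpa using hv
      simp [hα, hβ, hemisphereMap_eq_of_norm_eq_one hp hm this])
    (a := 1) (by simp) (hα1.trans hβ1.symm)
  let θ (x : Metric.sphere (0 : EuclideanSpace ℝ (Fin 3)) 1) : ℝ :=
    if 0 ≤ x.1 2 then α (equatorProj x) else β (equatorProj x)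
  have hθc : Continuous θ := by
    refine Continuous.if_le (hαc.comp continuous_equatorProj) (hβc.comp continuous_equatorProj)
      continuous_const (by fun_prop) fun x hx => hαβ ?_
    have h := norm_sq_equatorProj x
    rw [← hx, zero_pow two_ne_zero, sub_zero, pow_eq_one_iff_of_nonneg (norm_nonneg _) two_ne_zero] at h
    simpa using h
  have hθ (x) : Circle.exp (θ x) = g x := by
    simp only [θ]
    split_ifs with h
    · rw [hα, Function.comp_apply, hemisphereMap_equatorProj hp (by simpa using h)]
    · rw [hβ, Function.comp_apply, hemisphereMap_equatorProj hm (by linarith)]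
  refine ⟨fun x => θ x + (t - θ x₀), by fun_prop, fun x => ?_, by ring⟩
  rw [Circle.exp_add, Circle.exp_sub, ht, hθ, hθ]
  simp

end Sphere

/-- The sphere `S^2` (the unit sphere in `ℝ^3`) cannot be covered by open sets,
none containing a pair of antipodal points, such that every point of `S^2` is
contained in at most `2` of the sets (i.e. `Q(2,2)` is false). -/
theorem no_mult_two_cover_of_two_sphere :
    ¬ ∃ (n : ℕ) (U : Fin n → Set (EuclideanSpace ℝ (Fin 3))),
      (∀ i, ∃ V, IsOpen V ∧ U i = V ∩ Metric.sphere 0 1) ∧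
      (Metric.sphere (0 : EuclideanSpace ℝ (Fin 3)) 1 ⊆ ⋃ i, U i) ∧
      (∀ i, ∀ x, x ∈ U i → -x ∉ U i) ∧
      (∀ x ∈ Metric.sphere (0 : EuclideanSpace ℝ (Fin 3)) 1,
        {i : Fin n | x ∈ U i}.ncard ≤ 2) := by
  rintro ⟨n, U, hU, hcov, hanti, hmult⟩
  have hrank : 1 < Module.rank ℝ (EuclideanSpace ℝ (Fin 3)) := by
    rw [← Module.finrank_eq_rank, finrank_euclideanSpace_fin]
    norm_num
  have : Fact (Module.finrank ℝ (EuclideanSpace ℝ (Fin 3)) = 2 + 1) := ⟨by simp⟩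
  have : LocallyConnectedSpace (Metric.sphere (0 : EuclideanSpace ℝ (Fin 3)) 1) :=
    ChartedSpace.locallyConnectedSpace (EuclideanSpace ℝ (Fin 2)) _
  have : PreconnectedSpace (Metric.sphere (0 : EuclideanSpace ℝ (Fin 3)) 1) :=
    isPreconnected_iff_preconnectedSpace.1 (isPreconnected_sphere hrank 0 1)
  have : Nonempty (Metric.sphere (0 : EuclideanSpace ℝ (Fin 3)) 1) :=
    ⟨hemisphereMap 1 (by norm_num) 0⟩
  let U' (i : Fin n) : Set (Metric.sphere (0 : EuclideanSpace ℝ (Fin 3)) 1) :=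
    Subtype.val ⁻¹' U i
  have hU' (i : Fin n) : IsOpen (U' i) := by
    obtain ⟨V, hV, h⟩ := hU i
    convert! hV.preimage continuous_subtype_val using 1
    ext x
    simp only [U', h, mem_preimage, mem_inter_iff]
    exact and_iff_left x.2
  have hidx (x : Metric.sphere (0 : EuclideanSpace ℝ (Fin 3)) 1) : ∃ i, x ∈ U' i :=
    by simpa [U'] using hcov x.2
  choose i hi using hidx
  let C (x : Metric.sphere (0 : EuclideanSpace ℝ (Fin 3)) 1) := connectedComponentIn (U' (i x)) x
  have hCo (x) : IsOpen (C x) := (hU' _).connectedComponentIn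
  have hxC (x) : x ∈ C x := mem_connectedComponentIn (hi x)
  have hCU (x) : C x ⊆ U' (i x) := connectedComponentIn_subset _ _
  obtain ⟨t, ht⟩ := isCompact_univ.elim_finite_subcover C hCo
    fun x _ => mem_iUnion.2 ⟨x, hxC x⟩
  have hCeq {x y z} (hx : z ∈ C x) (hy : z ∈ C y) (hxy : C x ≠ C y) : i x ≠ i y := by
    intro h
    refine hxy ?_
    simp only [C] at hx hy ⊢
    rw [connectedComponentIn_eq hx, connectedComponentIn_eq hy, h]
  refine false_of_finite_cover_of_unicoherent (𝒱 := C '' t)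
    (fun P Q => isPreconnected_inter_of_lift fun g hg x₀ s hs =>
      exists_lift_circle_two_sphere hg x₀ hs)
    (t.finite_toSet.image C) ?_ ?_ ?_ ?_ ?_
  · rintro _ ⟨x, -, rfl⟩
    exact hCo x
  · rintro _ ⟨x, -, rfl⟩
    exact ⟨⟨x, hxC x⟩, isPreconnected_connectedComponentIn⟩
  · rintro _ ⟨x, -, rfl⟩
    rw [Set.disjoint_left]
    exact fun y hy hy' => hanti (i x) y (hCU x hy) (hCU x hy')
  · refine eq_univ_of_forall fun z => ?_
    obtain ⟨x, hx, hz⟩ := mem_iUnion₂.1 (ht (mem_univ z))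
    exact ⟨C x, ⟨x, hx, rfl⟩, hz⟩
  · rintro _ ⟨x, -, rfl⟩ _ ⟨y, -, rfl⟩ _ ⟨w, -, rfl⟩ hxy hxw hyw
    refine eq_empty_of_forall_notMem fun z ⟨⟨hzx, hzy⟩, hzw⟩ => ?_
    have hsub : ({i x, i y, i w} : Set (Fin n)) ⊆ {j | z.1 ∈ U j} := by
      rintro j (rfl | rfl | rfl)
      exacts [hCU _ hzx, hCU _ hzy, hCU _ hzw]
    have h3 : ({i x, i y, i w} : Set (Fin n)).ncard = 3 :=
      ncard_eq_three.2 ⟨_, _, _, hCeq hzx hzy hxy, hCeq hzx hzw hxw, hCeq hzy hzw hyw, rfl⟩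
    have := ncard_le_ncard hsub (toFinite _)
    have := hmult z.1 z.2
    omega
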